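/- Each u_λ is locally Lipschitz continuous, and the family {u_λ : λ > 0} is relatively compact in C(ℝ^N) with the topology of locally uniform convergence: every sequence of positive discount factors λ_n admits a subsequence along which u_{λ_n} converges uniformly on every compact subset of ℝ^N. -/

import Mathlib

open MeasureTheory Set
open scoped RealInnerProductSpace

noncomputable section

abbrev Euc (N : ℕ) := EuclideanSpace ℝ (Fin N)

/-- `u` is an (a.e.) subsolution of `H = a` in `ℝ^N`. -/
def IsSubsol {N : ℕ} (H : Euc N × Euc N → ℝ) (a : ℝ) (u : Euc N → ℝ) : Prop :=
  LocallyLipschitz u ∧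
    ∀ᵐ x : Euc N ∂volume, DifferentiableAt ℝ u x → H (x, gradient u x) ≤ a

/-- `u` is an (a.e.) subsolution of the discounted equation `λ u + H(x,Du) = 0`. -/
def IsDiscSubsol {N : ℕ} (H : Euc N × Euc N → ℝ) (lam : ℝ) (u : Euc N → ℝ) : Prop :=
  LocallyLipschitz u ∧
    ∀ᵐ x : Euc N ∂volume, DifferentiableAt ℝ u x →
      lam * u x + H (x, gradient u x) ≤ 0

/-- The Lagrangian associated with `H` via the Fenchel transform. -/
def Lag {N : ℕ} (H : Euc N × Euc N → ℝ) : Euc N × Euc N → ℝ :=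
  fun z => sSup (Set.range fun p : Euc N => ⟪p, z.2⟫ - H (z.1, p))

/-- `u` is a subsolution for the generalized Lagrangian `Φ`. -/
def SubsolFor {N : ℕ} (Φ : Euc N × Euc N → ℝ) (u : Euc N → ℝ) : Prop :=
  LocallyLipschitz u ∧
    ∀ᵐ x : Euc N ∂volume, DifferentiableAt ℝ u x →
      ∀ q : Euc N, fderiv ℝ u x q ≤ Φ (x, q)

/-- `u` is a `λ`-discounted subsolution for the generalized Lagrangian `Φ`. -/
def DiscSubsolFor {N : ℕ} (lam : ℝ) (Φ : Euc N × Euc N → ℝ) (u : Euc N → ℝ) : Prop :=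
  LocallyLipschitz u ∧
    ∀ᵐ x : Euc N ∂volume, DifferentiableAt ℝ u x →
      ∀ q : Euc N, lam * u x + fderiv ℝ u x q ≤ Φ (x, q)

/-- A Mather measure for the ergodic problem. -/
def MatherMeasure {N : ℕ} (H : Euc N × Euc N → ℝ) (μ : Measure (Euc N × Euc N)) : Prop :=
  IsProbabilityMeasure μ ∧ Integrable (Lag H) μ ∧ (∫ z, Lag H z ∂μ) = 0 ∧
    ∀ Φ : Euc N × Euc N → ℝ, Continuous Φ → BddBelow (Set.range Φ) →
      (∃ u, SubsolFor Φ u) → (Integrable Φ μ → 0 ≤ ∫ z, Φ z ∂μ)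

/-- A `(λ,z)`-Mather measure (relative to the maximal discounted solution `um`). -/
def DiscMatherMeasure {N : ℕ} (H : Euc N × Euc N → ℝ) (lam : ℝ) (z : Euc N)
    (um : Euc N → ℝ) (μ : Measure (Euc N × Euc N)) : Prop :=
  IsProbabilityMeasure μ ∧ Integrable (Lag H) μ ∧ (∫ w, Lag H w ∂μ) = lam * um z ∧
    ∀ Φ : Euc N × Euc N → ℝ, Continuous Φ → BddBelow (Set.range Φ) →
      ∀ u : Euc N → ℝ, DiscSubsolFor lam Φ u →
        (Integrable Φ μ → lam * u z ≤ ∫ w, Φ w ∂μ)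

open Filter Topology Metric

/-- **Rademacher's theorem** for locally Lipschitz functions. -/
theorem LocallyLipschitz.ae_differentiableAt_euc {N : ℕ} {u : Euc N → ℝ}
    (hu : LocallyLipschitz u) : ∀ᵐ x : Euc N ∂volume, DifferentiableAt ℝ u x := by
  have hball : ∀ n : ℕ, ∀ᵐ x : Euc N ∂volume,
      x ∈ closedBall (0 : Euc N) n → DifferentiableWithinAt ℝ u (closedBall 0 n) x := by
    intro n
    obtain ⟨K, hK⟩ := LocallyLipschitzOn.exists_lipschitzOnWith_of_compact
      (isCompact_closedBall (0 : Euc N) n) hu.locallyLipschitzOn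
    exact hK.ae_differentiableWithinAt_of_mem
  filter_upwards [ae_all_iff.2 hball] with x hx
  obtain ⟨n, hn⟩ := exists_nat_gt ‖x‖
  have hmem : x ∈ ball (0 : Euc N) n := by simpa using hn
  exact (hx n (ball_subset_closedBall hmem)).differentiableAt
    (mem_of_superset (isOpen_ball.mem_nhds hmem) ball_subset_closedBall)

/-- Along a segment, a locally Lipschitz function whose gradient is a.e. bounded on the segment
is controlled by that bound. -/
theorem LocallyLipschitz.abs_sub_le_of_ae_segment {N : ℕ} {u : Euc N → ℝ}
    (hu : LocallyLipschitz u) {L : ℝ} {x h : Euc N}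
    (hx : ∀ᵐ t : ℝ ∂volume, t ∈ Icc (0 : ℝ) 1 →
      DifferentiableAt ℝ u (x + t • h) ∧ ‖gradient u (x + t • h)‖ ≤ L) :
    |u (x + h) - u x| ≤ L * ‖h‖ := by
  set f : ℝ → ℝ := fun t => u (x + t • h) with hf
  have hline : LocallyLipschitz fun t : ℝ => x + t • h := by
    have : ContDiff ℝ 1 fun t : ℝ => x + t • h := by fun_prop
    exact this.locallyLipschitz
  have hfl : LocallyLipschitz f := hu.comp hline
  obtain ⟨K, hK⟩ := LocallyLipschitzOn.exists_lipschitzOnWith_of_compact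
    (isCompact_uIcc (a := (0 : ℝ)) (b := 1)) hfl.locallyLipschitzOn
  have hint := hK.absolutelyContinuousOnInterval.integral_deriv_eq_sub
  have hends : f 1 - f 0 = u (x + h) - u x := by simp [hf]
  rw [← hends, ← hint, ← Real.norm_eq_abs]
  have hbound : ∀ᵐ t : ℝ ∂volume, t ∈ uIoc (0 : ℝ) 1 → ‖deriv f t‖ ≤ L * ‖h‖ := by
    filter_upwards [hx] with t ht hmem
    rw [uIoc_of_le zero_le_one] at hmem
    obtain ⟨hd, hL⟩ := ht (Ioc_subset_Icc_self hmem)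
    have hderiv : HasDerivAt f (fderiv ℝ u (x + t • h) h) t := by
      have h1 : HasDerivAt (fun t : ℝ => x + t • h) h t := by
        simpa using ((hasDerivAt_id t).smul_const h).const_add x
      exact hd.hasFDerivAt.comp_hasDerivAt t h1
    rw [hderiv.deriv, ← inner_gradient_left]
    exact (norm_inner_le_norm _ _).trans (mul_le_mul_of_nonneg_right hL (norm_nonneg _))
  simpa using intervalIntegral.norm_integral_le_of_norm_le_const_ae hbound

/-- A locally Lipschitz function with gradient a.e. bounded by `L` in a ball is `L`-Lipschitz
there. -/
theorem LocallyLipschitz.abs_sub_le_of_ae_gradient_le {N : ℕ} {u : Euc N → ℝ}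
    (hu : LocallyLipschitz u) {L R : ℝ}
    (hL : ∀ᵐ x : Euc N ∂volume, ‖x‖ < R → ‖gradient u x‖ ≤ L) {y z : Euc N}
    (hy : ‖y‖ < R) (hz : ‖z‖ < R) : |u z - u y| ≤ L * ‖z - y‖ := by
  set h := z - y with hh
  obtain ⟨s, hs, hsm, hsae⟩ : ∃ s : Set (Euc N),
      (∀ x ∈ s, DifferentiableAt ℝ u x ∧ (‖x‖ < R → ‖gradient u x‖ ≤ L)) ∧
      MeasurableSet s ∧ ∀ᵐ x : Euc N ∂volume, x ∈ s := by
    obtain ⟨s, hs, hsm, hsub⟩ := (hu.ae_differentiableAt_euc.and hL).exists_measurable_mem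
    exact ⟨s, hsub, hsm, hs⟩
  have hae := (ae_ae_add_linearMap_mem_iff (LinearMap.toSpanSingleton ℝ (Euc N) h)
    (volume : Measure ℝ) (volume : Measure (Euc N)) hsm).2 hsae
  have hopen : IsOpen {x : Euc N | ‖x‖ < R ∧ ‖x + h‖ < R} :=
    (isOpen_lt continuous_norm continuous_const).inter
      (isOpen_lt (continuous_id.add continuous_const).norm continuous_const)
  have hmem : y ∈ {x : Euc N | ‖x‖ < R ∧ ‖x + h‖ < R} := ⟨hy, by simpa [hh] using hz⟩
  have hcl : y ∈ closure {x : Euc N | |u (x + h) - u x| ≤ L * ‖h‖} := by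
    have hfreq : ∃ᶠ x in 𝓝 y, ∀ᵐ t : ℝ ∂volume,
        x + LinearMap.toSpanSingleton ℝ (Euc N) h t ∈ s :=
      mem_closure_iff_frequently.1 ((Measure.dense_of_ae hae) y)
    rw [mem_closure_iff_frequently]
    refine (hfreq.and_eventually (hopen.mem_nhds hmem)).mono ?_
    rintro x ⟨hxs, hx1, hx2⟩
    refine hu.abs_sub_le_of_ae_segment ?_
    filter_upwards [hxs] with t ht htI
    rw [LinearMap.toSpanSingleton_apply] at ht
    refine ⟨(hs _ ht).1, (hs _ ht).2 ?_⟩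
    have hconv := (convex_ball (0 : Euc N) R).add_smul_sub_mem
      (mem_ball_zero_iff.2 hx1) (mem_ball_zero_iff.2 hx2) htI
    simpa using hconv
  have hclosed : IsClosed {x : Euc N | |u (x + h) - u x| ≤ L * ‖h‖} := by
    have := hu.continuous
    exact isClosed_le (by fun_prop) continuous_const
  have := hclosed.closure_eq ▸ hcl
  simpa [hh] using this

/-- Two differentiable functions touching at a point have the same gradient there. -/
theorem gradient_eq_of_le_of_eq {N : ℕ} {u w : Euc N → ℝ} {x : Euc N}
    (hu : DifferentiableAt ℝ u x) (hw : DifferentiableAt ℝ w x) (hle : ∀ y, w y ≤ u y)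
    (heq : w x = u x) : gradient w x = gradient u x := by
  have hmin : IsLocalMin (fun y => u y - w y) x :=
    Eventually.of_forall fun y => by simpa [heq] using hle y
  have h0 := hmin.fderiv_eq_zero
  rw [fderiv_fun_sub hu hw, sub_eq_zero] at h0
  simp [gradient, h0]

theorem LocallyLipschitz.ae_gradient_min_const {N : ℕ} {u : Euc N → ℝ}
    (hu : LocallyLipschitz u) (k : ℝ) : ∀ᵐ x : Euc N ∂volume,
      (u x ≤ k ∧ gradient (fun y => min (u y) k) x = gradient u x) ∨
      (k < u x ∧ gradient (fun y => min (u y) k) x = 0) := by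
  filter_upwards [hu.ae_differentiableAt_euc, (hu.min_const k).ae_differentiableAt_euc]
    with x hx hmx
  rcases le_or_gt (u x) k with h | h
  · exact .inl ⟨h, gradient_eq_of_le_of_eq hx hmx (fun y => min_le_left _ _) (min_eq_left h)⟩
  · refine .inr ⟨h, ?_⟩
    rw [gradient_eq_of_le_of_eq (differentiableAt_const k) hmx (fun y => min_le_right _ _)
      (min_eq_right h.le), gradient_fun_const]

theorem LocallyLipschitz.ae_gradient_max_const {N : ℕ} {u : Euc N → ℝ}
    (hu : LocallyLipschitz u) (k : ℝ) : ∀ᵐ x : Euc N ∂volume,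
      (k ≤ u x ∧ gradient (fun y => max (u y) k) x = gradient u x) ∨
      (u x < k ∧ gradient (fun y => max (u y) k) x = 0) := by
  filter_upwards [hu.ae_differentiableAt_euc, (hu.max_const k).ae_differentiableAt_euc]
    with x hx hmx
  rcases le_or_gt k (u x) with h | h
  · exact .inl ⟨h, (gradient_eq_of_le_of_eq hmx hx (fun y => le_max_left _ _)
      (max_eq_left h).symm).symm⟩
  · refine .inr ⟨h, ?_⟩
    rw [← gradient_eq_of_le_of_eq hmx (differentiableAt_const k) (fun y => le_max_right _ _)
      (max_eq_right h.le).symm, gradient_fun_const]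

/-- Locally bounded and locally equi-Lipschitz sequences have locally uniformly convergent
subsequences. -/
theorem exists_subseq_tendstoUniformlyOn_of_equiLipschitz {N : ℕ} (f : ℕ → Euc N → ℝ)
    (hf : ∀ R : ℝ, ∃ L M : ℝ, ∀ n, ∀ x y : Euc N, ‖x‖ < R → ‖y‖ < R →
      |f n x| ≤ M ∧ |f n x - f n y| ≤ L * ‖x - y‖) :
    ∃ φ : ℕ → ℕ, StrictMono φ ∧ ∃ v : Euc N → ℝ, ∀ K : Set (Euc N), IsCompact K →
      TendstoUniformlyOn (fun n => f (φ n)) v atTop K := by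
  choose L M hLM using hf
  set T : Set (Euc N → ℝ) := {g | ∀ R : ℝ, ∀ x y : Euc N, ‖x‖ < R → ‖y‖ < R →
    |g x| ≤ M R ∧ |g x - g y| ≤ L R * ‖x - y‖} with hT
  have hnhds : ∀ x : Euc N, ∀ᶠ y in 𝓝 x, ‖y‖ < ‖x‖ + 1 := fun x =>
    continuous_norm.continuousAt.eventually_lt_const (lt_add_one _)
  have hlim : ∀ x : Euc N, Tendsto (fun y => L (‖x‖ + 1) * ‖x - y‖) (𝓝 x) (𝓝 0) := fun x => by
    have : Continuous fun y => L (‖x‖ + 1) * ‖x - y‖ := by fun_prop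
    simpa using this.tendsto x
  have hequi : ∀ {ι : Type} (F : ι → Euc N → ℝ), (∀ i, F i ∈ T) → Equicontinuous F := by
    intro ι F hF x
    refine Metric.equicontinuousAt_of_continuity_modulus _ (hlim x) F ?_
    filter_upwards [hnhds x] with y hy i
    exact (hF i _ x y (lt_add_one _) hy).2
  have hTcont : ∀ g ∈ T, Continuous g := fun g hg =>
    (hequi (fun _ : Unit => g) fun _ => hg).continuous ()
  have hTcomp : IsCompact T := by
    refine (isCompact_univ_pi fun x : Euc N =>
      isCompact_Icc (a := -M (‖x‖ + 1)) (b := M (‖x‖ + 1))).of_isClosed_subset ?_ ?_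
    · simp only [hT, ofPred_forall]
      refine isClosed_iInter fun R => isClosed_iInter fun x => isClosed_iInter fun y =>
        isClosed_iInter fun _ => isClosed_iInter fun _ => ?_
      exact (isClosed_le (continuous_apply x).abs continuous_const).inter
        (isClosed_le ((continuous_apply x).sub (continuous_apply y)).abs continuous_const)
    · intro g hg x _
      exact abs_le.1 (hg _ x x (lt_add_one _) (lt_add_one _)).1
  set S : Set C(Euc N, ℝ) := {g | ⇑g ∈ T} with hS
  have himage : ContinuousMap.toFun '' S = T := by
    ext g
    constructor
    · rintro ⟨g, hg, rfl⟩
      exact hg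
    · intro hg
      exact ⟨⟨g, hTcont g hg⟩, hg, rfl⟩
  have hScomp : IsCompact S := ArzelaAscoli.isCompact_of_equicontinuous S
    (himage ▸ hTcomp) (hequi _ fun g => g.2)
  have hfT : ∀ n, f n ∈ T := fun n R x y hx hy => hLM R n x y hx hy
  obtain ⟨v, -, φ, hφ, hv⟩ := hScomp.tendsto_subseq
    (x := fun n => (⟨f n, hTcont _ (hfT n)⟩ : C(Euc N, ℝ))) hfT
  exact ⟨φ, hφ, v, ContinuousMap.tendsto_iff_forall_isCompact_tendstoUniformlyOn.1 hv⟩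

/-- Coercivity turns a bound on the Hamiltonian along `Du` into a Lipschitz bound. -/
theorem exists_lipschitz_bound_of_hamiltonian_le {N : ℕ} {H : Euc N × Euc N → ℝ}
    (hcoer : ∀ R : ℝ, 0 < R → ∀ C : ℝ, ∃ r : ℝ, ∀ x p : Euc N,
      ‖x‖ ≤ R → r ≤ ‖p‖ → C ≤ H (x, p)) {R : ℝ} (hR : 0 < R) (C : ℝ) :
    ∃ L : ℝ, 0 ≤ L ∧ ∀ u : Euc N → ℝ, LocallyLipschitz u →
      (∀ᵐ x : Euc N ∂volume, H (x, gradient u x) ≤ C) →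
      ∀ x y : Euc N, ‖x‖ < R → ‖y‖ < R → |u x - u y| ≤ L * ‖x - y‖ := by
  obtain ⟨r, hr⟩ := hcoer R hR (C + 1)
  refine ⟨max r 0, le_max_right _ _, fun u hu hC x y hx hy => ?_⟩
  refine hu.abs_sub_le_of_ae_gradient_le ?_ hy hx
  filter_upwards [hC] with z hz hzR
  by_contra! hlt
  have := hr z (gradient u z) hzR.le ((le_max_left _ _).trans hlt.le)
  linarith

theorem IsSubsol.ae_le {N : ℕ} {H : Euc N × Euc N → ℝ} {a : ℝ} {u : Euc N → ℝ}
    (hu : IsSubsol H a u) : ∀ᵐ x : Euc N ∂volume, H (x, gradient u x) ≤ a := by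
  filter_upwards [hu.2, hu.1.ae_differentiableAt_euc] with x hx hd using hx hd

theorem IsDiscSubsol.ae_le {N : ℕ} {H : Euc N × Euc N → ℝ} {lam : ℝ} {u : Euc N → ℝ}
    (hu : IsDiscSubsol H lam u) :
    ∀ᵐ x : Euc N ∂volume, lam * u x + H (x, gradient u x) ≤ 0 := by
  filter_upwards [hu.2, hu.1.ae_differentiableAt_euc] with x hx hd using hx hd

/-- Truncating a discounted subsolution from below by a constant subsolution. -/
theorem IsDiscSubsol.max_const {N : ℕ} {H : Euc N × Euc N → ℝ} {lam k : ℝ} {u : Euc N → ℝ}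
    (hu : IsDiscSubsol H lam u) (hk : ∀ x, lam * k + H (x, 0) ≤ 0) :
    IsDiscSubsol H lam fun x => max (u x) k := by
  refine ⟨hu.1.max_const k, ?_⟩
  filter_upwards [hu.ae_le, hu.1.ae_gradient_max_const k] with x hx hg _
  rcases hg with ⟨hle, hg⟩ | ⟨hlt, hg⟩
  · rwa [hg, max_eq_left hle]
  · rw [hg, max_eq_right hlt.le]
    exact hk x

/-- If `H(·, 0)` is bounded above outside a ball, it is bounded above. -/
theorem exists_bound_hamiltonian_zero {N : ℕ} {H : Euc N × Euc N → ℝ} (hH : Continuous H)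
    {m R : ℝ} (hm : ∀ x : Euc N, R ≤ ‖x‖ → H (x, 0) ≤ m) : ∃ C : ℝ, ∀ x, H (x, 0) ≤ C := by
  have hcont : Continuous fun x : Euc N => H (x, 0) := by fun_prop
  obtain ⟨M, hM⟩ := (isCompact_closedBall (0 : Euc N) R).bddAbove_image hcont.continuousOn
  refine ⟨max M m, fun x => ?_⟩
  rcases le_total R ‖x‖ with h | h
  · exact (hm x h).trans (le_max_right _ _)
  · exact (hM (mem_image_of_mem _ (by simpa using h))).trans (le_max_left _ _)

/-- The levels admitting a subsolution are bounded below. -/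
theorem bddBelow_isSubsol_levels {N : ℕ} {H : Euc N × Euc N → ℝ} (hH : Continuous H)
    (hcoer : ∀ R : ℝ, 0 < R → ∀ C : ℝ, ∃ r : ℝ, ∀ x p : Euc N,
      ‖x‖ ≤ R → r ≤ ‖p‖ → C ≤ H (x, p)) :
    BddBelow {a : ℝ | ∃ u : Euc N → ℝ, IsSubsol H a u} := by
  obtain ⟨r, hr⟩ := hcoer 1 one_pos 0
  obtain ⟨M, hM⟩ := ((isCompact_closedBall (0 : Euc N) 1).prod
    (isCompact_closedBall (0 : Euc N) r)).bddBelow_image hH.continuousOn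
  refine ⟨min M 0, ?_⟩
  rintro a ⟨u, hu⟩
  obtain ⟨x, hxa, hx⟩ := (Measure.dense_of_ae hu.ae_le).exists_dist_lt (0 : Euc N) one_pos
  have hx1 : ‖x‖ ≤ 1 := by simpa [dist_comm] using hx.le
  refine le_trans ?_ (show H (x, gradient u x) ≤ a from hxa)
  rcases le_total r ‖gradient u x‖ with h | h
  · exact (min_le_right _ _).trans (hr _ _ hx1 h)
  · exact (min_le_left _ _).trans
      (hM (mem_image_of_mem _ (mk_mem_prod (by simpa using hx1) (by simpa using h))))

/-- If every positive level admits a subsolution, then `H(x₀, ·)` attains a nonpositive value. -/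
theorem exists_hamiltonian_le_zero {N : ℕ} {H : Euc N × Euc N → ℝ} (hH : Continuous H)
    (hcoer : ∀ R : ℝ, 0 < R → ∀ C : ℝ, ∃ r : ℝ, ∀ x p : Euc N,
      ‖x‖ ≤ R → r ≤ ‖p‖ → C ≤ H (x, p))
    (hsub : ∀ a : ℝ, 0 < a → ∃ u : Euc N → ℝ, IsSubsol H a u) (x₀ : Euc N) :
    ∃ p : Euc N, H (x₀, p) ≤ 0 := by
  have hseq : ∀ n : ℕ, ∃ z : Euc N × Euc N, dist x₀ z.1 < 1 / ((n : ℝ) + 1) ∧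
      H z ≤ 1 / ((n : ℝ) + 1) := by
    intro n
    have hpos : 0 < 1 / ((n : ℝ) + 1) := Nat.one_div_pos_of_nat
    obtain ⟨u, hu⟩ := hsub _ hpos
    obtain ⟨x, hxa, hx⟩ := (Measure.dense_of_ae hu.ae_le).exists_dist_lt x₀ hpos
    exact ⟨(x, gradient u x), hx, hxa⟩
  choose z hz hHz using hseq
  have hle1 : ∀ n : ℕ, 1 / ((n : ℝ) + 1) ≤ 1 := fun n => by
    rw [div_le_one (by positivity)]
    linarith [n.cast_nonneg (α := ℝ)]
  obtain ⟨r, hr⟩ := hcoer (‖x₀‖ + 1) (by positivity) 2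
  have hbdd : ∀ n, z n ∈ closedBall x₀ 1 ×ˢ closedBall (0 : Euc N) r := by
    intro n
    have h1 : dist (z n).1 x₀ ≤ 1 := by
      rw [dist_comm]
      exact (hz n).le.trans (hle1 n)
    refine ⟨h1, ?_⟩
    rw [mem_closedBall_zero_iff]
    by_contra! hlt
    have hnorm : ‖(z n).1‖ ≤ ‖x₀‖ + 1 := by
      have := norm_le_norm_add_norm_sub' (z n).1 x₀
      rw [← dist_eq_norm] at this
      linarith
    have := hr (z n).1 (z n).2 hnorm hlt.le
    have := (hHz n).trans (hle1 n)
    simp only [Prod.mk.eta] at *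
    linarith
  obtain ⟨w, -, φ, hφ, hw⟩ :=
    ((isCompact_closedBall x₀ 1).prod (isCompact_closedBall (0 : Euc N) r)).tendsto_subseq hbdd
  have hzero : Tendsto (fun n => 1 / (((φ n : ℕ) : ℝ) + 1)) atTop (𝓝 0) :=
    tendsto_one_div_add_atTop_nhds_zero_nat.comp hφ.tendsto_atTop
  have hfst : w.1 = x₀ := by
    refine tendsto_nhds_unique ((continuous_fst.tendsto w).comp hw) ?_
    rw [tendsto_iff_dist_tendsto_zero]
    refine squeeze_zero (fun _ => dist_nonneg) (fun n => ?_) hzero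
    simpa [dist_comm] using (hz (φ n)).le
  refine ⟨w.2, ?_⟩
  rw [← hfst]
  exact le_of_tendsto_of_tendsto' ((hH.tendsto w).comp hw) hzero fun n => hHz (φ n)

/-- Outside a large ball constants are strict subsolutions, so a discounted subsolution which is
positive on that ball would produce a subsolution at a negative level. -/
theorem IsDiscSubsol.exists_nonpos {N : ℕ} {H : Euc N × Euc N → ℝ} {lam m R : ℝ}
    (hlam : 0 < lam) (hR : 0 ≤ R) (hm0 : m < 0) (hm : ∀ x : Euc N, R ≤ ‖x‖ → H (x, 0) ≤ m)
    (hlevel : ∀ a : ℝ, ∀ u : Euc N → ℝ, IsSubsol H a u → 0 ≤ a) {w : Euc N → ℝ}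
    (hw : IsDiscSubsol H lam w) : ∃ y : Euc N, ‖y‖ ≤ R ∧ w y ≤ 0 := by
  by_contra! hpos
  have hcomp := isCompact_closedBall (0 : Euc N) R
  have hne : (closedBall (0 : Euc N) R).Nonempty := nonempty_closedBall.2 hR
  obtain ⟨y, hy, hmin⟩ := hcomp.exists_isMinOn hne hw.1.continuous.continuousOn
  obtain ⟨y', -, hmax⟩ := hcomp.exists_isMaxOn hne hw.1.continuous.continuousOn
  have hδ : 0 < w y := hpos y (by simpa using hy)
  have hbox : ∀ x : Euc N, ‖x‖ < R → w y ≤ w x ∧ w x ≤ w y' := fun x hx =>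
    have hx' : x ∈ closedBall (0 : Euc N) R := by simpa using hx.le
    ⟨hmin hx', hmax hx'⟩
  have hsub : IsSubsol H (max (-(lam * w y)) m)
      fun x => max (min (w x) (w y')) (w y) := by
    refine ⟨(hw.1.min_const _).max_const _, ?_⟩
    filter_upwards [hw.ae_le, hw.1.ae_gradient_min_const (w y'),
      (hw.1.min_const (w y')).ae_gradient_max_const (w y)] with x hx hgmin hgmax _
    have hout : ¬ ‖x‖ < R → H (x, 0) ≤ max (-(lam * w y)) m := fun h =>
      (hm x (not_lt.1 h)).trans (le_max_right _ _)
    rcases hgmax with ⟨hle, hg⟩ | ⟨hlt, hg⟩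
    · rw [hg]
      rcases hgmin with ⟨-, hg'⟩ | ⟨hlt', hg'⟩
      · rw [hg']
        refine le_max_of_le_left ?_
        have := mul_le_mul_of_nonneg_left (hle.trans (min_le_left _ _)) hlam.le
        linarith
      · rw [hg']
        exact hout fun h => absurd (hbox x h).2 (not_le.2 hlt')
    · rw [hg]
      refine hout fun h => absurd hlt (not_lt.2 (le_min (hbox x h).1 ?_))
      exact (hbox x h).1.trans (hbox x h).2
  have hprod : 0 < lam * w y := mul_pos hlam hδ
  rcases le_max_iff.1 (hlevel _ _ hsub) with h | h <;> linarith

/-- Discounted subsolutions that are locally bounded below, uniformly in the discount factor. -/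
theorem exists_isDiscSubsol_lower_bound {N : ℕ} {H : Euc N × Euc N → ℝ} {m R₀ : ℝ}
    (hcoer : ∀ R : ℝ, 0 < R → ∀ C : ℝ, ∃ r : ℝ, ∀ x p : Euc N,
      ‖x‖ ≤ R → r ≤ ‖p‖ → C ≤ H (x, p))
    (hR₀ : 0 < R₀) (hm0 : m < 0) (hm : ∀ x : Euc N, R₀ ≤ ‖x‖ → H (x, 0) ≤ m)
    (hsub : ∀ a : ℝ, 0 < a → ∃ u : Euc N → ℝ, IsSubsol H a u) {R : ℝ} (hR : 0 < R) :
    ∃ M : ℝ, ∀ lam : ℝ, 0 < lam → ∃ v : Euc N → ℝ, IsDiscSubsol H lam v ∧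
      ∀ x : Euc N, ‖x‖ < R → -M ≤ v x := by
  obtain ⟨L₀, hL₀, hLip₀⟩ := exists_lipschitz_bound_of_hamiltonian_le hcoer hR₀ 1
  obtain ⟨L, hL, hLip⟩ := exists_lipschitz_bound_of_hamiltonian_le hcoer hR 1
  refine ⟨L * R + L₀ * R₀ + 1, fun lam hlam => ?_⟩
  obtain ⟨u, hu⟩ := hsub (min lam 1) (lt_min hlam one_pos)
  have hu1 : ∀ᵐ x : Euc N ∂volume, H (x, gradient u x) ≤ 1 := by
    filter_upwards [hu.ae_le] with x hx using hx.trans (min_le_right _ _)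
  set k := u 0 + L₀ * R₀ with hk
  have hgrad : ∀ x, gradient (fun y => min (u y) k - (k + 1)) x =
      gradient (fun y => min (u y) k) x := fun x => by
    simp [gradient, fderiv_sub_const]
  refine ⟨fun y => min (u y) k - (k + 1), ⟨?_, ?_⟩, fun x hx => ?_⟩
  · exact (LipschitzWith.id.sub (LipschitzWith.const (k + 1))).locallyLipschitz.comp
      (hu.1.min_const k)
  · filter_upwards [hu.ae_le, hu.1.ae_gradient_min_const k] with x hx hg _
    rw [hgrad]
    rcases hg with ⟨hle, hg⟩ | ⟨hlt, hg⟩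
    · rw [hg, min_eq_left hle]
      have h1 : lam * (u x - (k + 1)) ≤ lam * (-1) :=
        mul_le_mul_of_nonneg_left (by linarith) hlam.le
      linarith [hx.trans (min_le_left _ _)]
    · rw [hg, min_eq_right hlt.le]
      have hout : R₀ ≤ ‖x‖ := by
        by_contra! h
        have h1 := (abs_le.1 (hLip₀ u hu.1 hu1 x 0 h (by simpa using hR₀))).2
        rw [sub_zero] at h1
        have h2 := mul_le_mul_of_nonneg_left h.le hL₀
        linarith
      linarith [hm x hout]
  · have h1 := (abs_le.1 (hLip u hu.1 hu1 x 0 hx (by simpa using hR))).1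
    rw [sub_zero] at h1
    have h2 := mul_le_mul_of_nonneg_left hx.le hL
    have h3 : 0 ≤ L * R := by positivity
    have h4 : 0 ≤ L₀ * R₀ := by positivity
    have h5 : u 0 - L * R ≤ min (u x) k := le_min (by linarith) (by linarith)
    linarith

theorem stmt4 {N : ℕ} (hN : 1 ≤ N) (H : Euc N × Euc N → ℝ)
    (hA1 : Continuous H)
    (hA2conv : ∀ x : Euc N, ConvexOn ℝ Set.univ fun p => H (x, p))
    (hA2coer : ∀ R : ℝ, 0 < R → ∀ C : ℝ, ∃ r : ℝ, ∀ x p : Euc N,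
      ‖x‖ ≤ R → r ≤ ‖p‖ → C ≤ H (x, p))
    (hA3 : ∃ ε > (0 : ℝ), ∃ m : ℝ,
      (∃ R : ℝ, ∀ x : Euc N, R ≤ ‖x‖ → ∀ p : Euc N, ‖p‖ ≤ ε → H (x, p) ≤ m) ∧
      (∃ x₀ : Euc N, ∀ p : Euc N, m < H (x₀, p)))
    (hcrit : sInf {a : ℝ | ∃ u : Euc N → ℝ, IsSubsol H a u} = 0)
    (um : ℝ → Euc N → ℝ)
    (hum : ∀ lam : ℝ, 0 < lam → ∀ x : Euc N,
      um lam x = sSup {r : ℝ | ∃ v : Euc N → ℝ, IsDiscSubsol H lam v ∧ v x = r})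
 :
    (∀ lam : ℝ, 0 < lam → LocallyLipschitz (um lam)) ∧
    ∀ lamseq : ℕ → ℝ, (∀ n, 0 < lamseq n) →
      ∃ φ : ℕ → ℕ, StrictMono φ ∧ ∃ v : Euc N → ℝ,
        ∀ K : Set (Euc N), IsCompact K →
          TendstoUniformlyOn (fun n => um (lamseq (φ n))) v Filter.atTop K := by
  obtain ⟨ε, hε, m, ⟨R₁, hR₁⟩, x₀, hx₀⟩ := hA3
  set R₀ := max R₁ 1 with hR₀def
  have hR₀ : 0 < R₀ := lt_max_of_lt_right one_pos
  have hm : ∀ x : Euc N, R₀ ≤ ‖x‖ → H (x, 0) ≤ m := fun x hx =>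
    hR₁ x ((le_max_left _ _).trans hx) 0 (by simpa using hε.le)
  obtain ⟨C, hC⟩ := exists_bound_hamiltonian_zero hA1 hm
  have hconst : IsSubsol H C fun _ => 0 := by
    refine ⟨LocallyLipschitz.const 0, Eventually.of_forall fun x _ => ?_⟩
    rw [gradient_fun_const]
    exact hC x
  have hlevel : ∀ a : ℝ, ∀ u : Euc N → ℝ, IsSubsol H a u → 0 ≤ a := fun a u hu =>
    hcrit ▸ csInf_le (bddBelow_isSubsol_levels hA1 hA2coer) ⟨u, hu⟩
  have hsub : ∀ a : ℝ, 0 < a → ∃ u : Euc N → ℝ, IsSubsol H a u := by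
    intro a ha
    obtain ⟨b, ⟨u, hu⟩, hba⟩ := exists_lt_of_csInf_lt
      (s := {a : ℝ | ∃ u : Euc N → ℝ, IsSubsol H a u}) ⟨C, _, hconst⟩ (hcrit.trans_lt ha)
    exact ⟨u, hu.1, hu.2.mono fun x hx hd => (hx hd).trans hba.le⟩
  have hm0 : m < 0 := by
    obtain ⟨p, hp⟩ := exists_hamiltonian_le_zero hA1 hA2coer hsub x₀
    exact (hx₀ p).trans_le hp
  have hbounds : ∀ R : ℝ, ∃ L M : ℝ, 0 ≤ L ∧ ∀ lam : ℝ, 0 < lam → ∀ x y : Euc N,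
      ‖x‖ < R → ‖y‖ < R → |um lam x| ≤ M ∧ |um lam x - um lam y| ≤ L * ‖x - y‖ := by
    intro R
    set S := max R (R₀ + 1) with hS
    have hSpos : 0 < S := lt_max_of_lt_right (by linarith)
    have hR₀S : R₀ < S := lt_max_of_lt_right (lt_add_one _)
    obtain ⟨L, hL, hLip⟩ := exists_lipschitz_bound_of_hamiltonian_le hA2coer hSpos C
    obtain ⟨M, hM⟩ := exists_isDiscSubsol_lower_bound hA2coer hR₀ hm0 hm hsub hSpos
    refine ⟨L, max M (L * (2 * S)), hL, fun lam hlam => ?_⟩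
    have hraise : ∀ v, IsDiscSubsol H lam v → ∃ w, IsDiscSubsol H lam w ∧ (∀ x, v x ≤ w x) ∧
        ∀ x y : Euc N, ‖x‖ < S → ‖y‖ < S → |w x - w y| ≤ L * ‖x - y‖ := by
      intro v hv
      have hw : IsDiscSubsol H lam fun x => max (v x) (-C / lam) := by
        refine hv.max_const fun x => ?_
        rw [mul_div_cancel₀ _ hlam.ne']
        linarith [hC x]
      refine ⟨_, hw, fun x => le_max_left _ _, hLip _ hw.1 ?_⟩
      filter_upwards [hw.ae_le] with x hx
      have h1 := mul_le_mul_of_nonneg_left (le_max_right (v x) (-C / lam)) hlam.le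
      rw [mul_div_cancel₀ _ hlam.ne'] at h1
      linarith
    have hupper : ∀ v, IsDiscSubsol H lam v → ∀ x : Euc N, ‖x‖ < S → v x ≤ L * (2 * S) := by
      intro v hv x hx
      obtain ⟨w, hw, hvw, hwL⟩ := hraise v hv
      obtain ⟨y, hy, hwy⟩ := hw.exists_nonpos hlam hR₀.le hm0 hm hlevel
      have hyS := hy.trans_lt hR₀S
      have h1 := (abs_le.1 (hwL x y hx hyS)).2
      have h2 : L * ‖x - y‖ ≤ L * (2 * S) :=
        mul_le_mul_of_nonneg_left (by linarith [norm_sub_le x y]) hL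
      linarith [hvw x]
    have hle : ∀ v, IsDiscSubsol H lam v → ∀ x : Euc N, ‖x‖ < S → v x ≤ um lam x := by
      intro v hv x hx
      rw [hum lam hlam x]
      refine le_csSup ⟨L * (2 * S), ?_⟩ ⟨v, hv, rfl⟩
      rintro _ ⟨w, hw, rfl⟩
      exact hupper w hw x hx
    obtain ⟨v₀, hv₀, hv₀M⟩ := hM lam hlam
    have hum_le : ∀ x : Euc N, ∀ b : ℝ, (∀ v, IsDiscSubsol H lam v → v x ≤ b) →
        um lam x ≤ b := by
      intro x b hb
      rw [hum lam hlam x]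
      refine csSup_le ⟨_, v₀, hv₀, rfl⟩ ?_
      rintro _ ⟨w, hw, rfl⟩
      exact hb w hw
    have hone : ∀ x y : Euc N, ‖x‖ < S → ‖y‖ < S →
        um lam x ≤ um lam y + L * ‖x - y‖ := by
      intro x y hx hy
      refine hum_le x _ fun v hv => ?_
      obtain ⟨w, hw, hvw, hwL⟩ := hraise v hv
      linarith [hvw x, hle w hw y hy, (abs_le.1 (hwL x y hx hy)).2]
    intro x y hx hy
    replace hx : ‖x‖ < S := hx.trans_le (le_max_left _ _)
    replace hy : ‖y‖ < S := hy.trans_le (le_max_left _ _)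
    refine ⟨abs_le.2 ⟨?_, ?_⟩, abs_le.2 ⟨?_, ?_⟩⟩
    · linarith [le_max_left M (L * (2 * S)), hv₀M x hx, hle v₀ hv₀ x hx]
    · exact (hum_le x _ fun v hv => hupper v hv x hx).trans (le_max_right _ _)
    · have := hone y x hy hx
      rw [norm_sub_rev] at this
      linarith
    · linarith [hone x y hx hy]
  refine ⟨fun lam hlam x => ?_, fun lamseq hpos => ?_⟩
  · obtain ⟨L, M, hL, hLM⟩ := hbounds (‖x‖ + 1)
    refine ⟨⟨L, hL⟩, {y | ‖y‖ < ‖x‖ + 1},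
      (isOpen_lt continuous_norm continuous_const).mem_nhds (lt_add_one ‖x‖), ?_⟩
    refine LipschitzOnWith.of_dist_le_mul fun y hy z hz => ?_
    rw [Real.dist_eq, dist_eq_norm]
    exact (hLM lam hlam y z hy hz).2
  · refine exists_subseq_tendstoUniformlyOn_of_equiLipschitz (fun n => um (lamseq n)) fun R => ?_
    obtain ⟨L, M, -, hLM⟩ := hbounds R
    exact ⟨L, M, fun n => hLM _ (hpos n)⟩

end
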